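/- Let (p_j)_{j∈ℕ} be a strictly increasing sequence in [1,∞), let E = ℓ^r for some r with sup_j p_j ≤ r ≤ ∞ (with the convention ℓ^∞ = c0), and let X = (⊕_{j=1}^∞ ℓ^{p_j})_E. Then there exists a strictly decreasing sequence (M_n)_{n∈ℕ₀} of closed subalgebras of L(X) with M_0 = S(X), such that M_n is a closed two-sided ideal of M_{n−1} for every n ∈ ℕ, and consequently for every n ∈ ℕ the subalgebra M_n is a closed (n+1)-subideal of L(X) but not a closed n-subideal of L(X). -/

import Mathlib

open Filter Topology
open scoped ENNReal

noncomputable section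

/-- `J` is a two-sided ideal of the subalgebra `I`. -/
def IsIdealOf {𝕜 A : Type*} [CommSemiring 𝕜] [NonUnitalNonAssocSemiring A] [Module 𝕜 A]
    (J I : NonUnitalSubalgebra 𝕜 A) : Prop :=
  (J : Set A) ⊆ (I : Set A) ∧ ∀ a ∈ I, ∀ x ∈ J, a * x ∈ J ∧ x * a ∈ J

/-- The set `S` is a closed `n`-subideal of the algebra `A`. -/
def IsClosedNSubideal (𝕜 : Type*) {A : Type*} [CommSemiring 𝕜] [NonUnitalNonAssocSemiring A]
    [Module 𝕜 A] [TopologicalSpace A] (n : ℕ) (S : Set A) : Prop :=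
  ∃ C : ℕ → NonUnitalSubalgebra 𝕜 A, (C 0 : Set A) = Set.univ ∧ (C n : Set A) = S ∧
    (∀ k ≤ n, IsClosed (C k : Set A)) ∧ ∀ k < n, IsIdealOf (C (k + 1)) (C k)

/-- A strictly singular operator. -/
def IsStrictlySingular {𝕜 X Y : Type*} [NontriviallyNormedField 𝕜] [NormedAddCommGroup X]
    [NormedSpace 𝕜 X] [NormedAddCommGroup Y] [NormedSpace 𝕜 Y] (T : X →L[𝕜] Y) : Prop :=
  ∀ M : Submodule 𝕜 X, IsClosed (M : Set X) → ¬FiniteDimensional 𝕜 M →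
    ¬∃ c : ℝ, 0 < c ∧ ∀ x ∈ M, c * ‖x‖ ≤ ‖T x‖

/-- The `c_0`-direct sum of the Banach spaces `V j`: the subspace of `(⊕ V j)_{ℓ^∞}`
of sequences with `‖x j‖ → 0`, with the sup norm. -/
def c0SumSubmodule (𝕜 : Type*) [RCLike 𝕜] (V : ℕ → Type*) [∀ j, NormedAddCommGroup (V j)]
    [∀ j, NormedSpace 𝕜 (V j)] : Submodule 𝕜 (lp V ∞) where
  carrier := {x | Tendsto (fun j => ‖x j‖) atTop (𝓝 0)}
  zero_mem' := by
    simp only [Set.mem_setOf_eq, lp.coeFn_zero, Pi.zero_apply, norm_zero]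
    exact tendsto_const_nhds
  add_mem' := by
    intro x y hx hy
    simp only [Set.mem_setOf_eq, lp.coeFn_add, Pi.add_apply] at *
    exact squeeze_zero (fun j => norm_nonneg _) (fun j => norm_add_le _ _)
      (by simpa using hx.add hy)
  smul_mem' := by
    intro c x hx
    simp only [Set.mem_setOf_eq, lp.coeFn_smul, Pi.smul_apply, norm_smul] at *
    simpa using hx.const_mul ‖c‖

/-- A bundled carrier with its norm structure. -/
structure BundledSp (𝕜 : Type*) [NontriviallyNormedField 𝕜] where
  carrier : Type
  [grp : NormedAddCommGroup carrier]
  [mod : NormedSpace 𝕜 carrier]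

attribute [instance] BundledSp.grp BundledSp.mod

/-- The direct sum `(⊕_j V j)_E` where `E = ℓ^r` for `r < ∞` and `E = c_0` for `r = ∞`. -/
def sumSpB (𝕜 : Type) [RCLike 𝕜] (V : ℕ → Type) [∀ j, NormedAddCommGroup (V j)]
    [∀ j, NormedSpace 𝕜 (V j)] (r : ℝ≥0∞) [Fact (1 ≤ r)] : BundledSp 𝕜 :=
  if r = ∞ then ⟨↥(c0SumSubmodule 𝕜 V)⟩ else ⟨lp V r⟩

/-- The space `X = (⊕_{j} ℓ^{p_j})_E`, where `E = ℓ^r` (with the convention `ℓ^∞ = c_0`). -/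
abbrev sumOfLp (𝕜 : Type) [RCLike 𝕜] (p : ℕ → ℝ≥0∞) [∀ j, Fact (1 ≤ p j)] (r : ℝ≥0∞)
    [Fact (1 ≤ r)] : Type :=
  (sumSpB 𝕜 (fun j => lp (fun _ : ℕ => 𝕜) (p j)) r).carrier

section StrictlySingular

variable {𝕜 X Y Z : Type*} [RCLike 𝕜] [NormedAddCommGroup X] [NormedSpace 𝕜 X]
  [NormedAddCommGroup Y] [NormedSpace 𝕜 Y] [NormedAddCommGroup Z] [NormedSpace 𝕜 Z]

theorem exists_eq_sum_range_of_mem_span {x : ℕ → X} {v : X}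
    (hv : v ∈ Submodule.span 𝕜 (Set.range x)) :
    ∃ (n : ℕ) (a : ℕ → 𝕜), v = ∑ k ∈ Finset.range n, a k • x k := by
  obtain ⟨c, rfl⟩ := Finsupp.mem_span_range_iff_exists_finsupp.1 hv
  obtain ⟨n, hn⟩ := c.support.exists_nat_subset_range
  exact ⟨n, c, Finsupp.sum_of_support_subset _ hn _ (by simp)⟩

theorem not_finiteDimensional_span_range {x : ℕ → X}
    (h : ∀ (n : ℕ) (a : ℕ → 𝕜), ∑ k ∈ Finset.range n, a k • x k = 0 → ∀ k < n, a k = 0) :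
    ¬FiniteDimensional 𝕜 (Submodule.span 𝕜 (Set.range x)) := by
  intro hfd
  have hli : LinearIndependent 𝕜 x := by
    rw [linearIndependent_iff']
    intro s g hg i hi
    obtain ⟨n, hn⟩ := s.exists_nat_subset_range
    have := h n (fun k => if k ∈ s then g k else 0) (by
      rw [← hg, ← Finset.sum_subset hn]
      · exact Finset.sum_congr rfl fun k hk => by simp [hk]
      · intro k _ hk; simp [hk]) i (Finset.mem_range.1 (hn hi))
    simpa [hi] using this
  have := (linearIndependent_span hli).finite
  exact not_finite ℕ

/-- A strictly singular operator is not bounded below on any infinite-dimensional subspace,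
closed or not. -/
theorem IsStrictlySingular.finiteDimensional {T : X →L[𝕜] Y} (hT : IsStrictlySingular T)
    (M : Submodule 𝕜 X) {c : ℝ} (hc : 0 < c) (h : ∀ x ∈ M, c * ‖x‖ ≤ ‖T x‖) :
    FiniteDimensional 𝕜 M := by
  by_contra hM
  refine hT M.topologicalClosure M.isClosed_topologicalClosure (fun hfd => hM ?_) ⟨c, hc, ?_⟩
  · exact Submodule.finiteDimensional_of_le M.le_topologicalClosure
  · have : closure (M : Set X) ⊆ {x | c * ‖x‖ ≤ ‖T x‖} :=
      closure_minimal h (isClosed_le (by fun_prop) (by fun_prop))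
    exact this

theorem IsStrictlySingular.comp_left {T : X →L[𝕜] Y} (hT : IsStrictlySingular T) (S : Y →L[𝕜] Z) :
    IsStrictlySingular (S ∘L T) := by
  rintro M - hM ⟨c, hc, h⟩
  refine hM (hT.finiteDimensional M (c := c / (‖S‖ + 1)) (by positivity) fun x hx => ?_)
  have h1 := h x hx
  have h2 := S.le_opNorm (T x)
  rw [div_mul_eq_mul_div, div_le_iff₀ (by positivity)]
  simp only [ContinuousLinearMap.comp_apply] at h1
  nlinarith [norm_nonneg (T x)]

theorem IsStrictlySingular.comp_right {T : Y →L[𝕜] Z} (hT : IsStrictlySingular T)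
    (S : X →L[𝕜] Y) : IsStrictlySingular (T ∘L S) := by
  rintro M - hM ⟨c, hc, h⟩
  have hinj : Function.Injective ((S : X →ₗ[𝕜] Y).domRestrict M) := by
    rw [← LinearMap.ker_eq_bot, LinearMap.ker_eq_bot']
    intro x hx
    have h1 := h x x.2
    have hx' : S x = 0 := hx
    simp only [ContinuousLinearMap.comp_apply, hx', map_zero, norm_zero] at h1
    have : ‖(x : X)‖ = 0 := le_antisymm (by nlinarith) (norm_nonneg _)
    simpa using this
  have hfd : FiniteDimensional 𝕜 (LinearMap.range ((S : X →ₗ[𝕜] Y).domRestrict M)) := by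
    refine hT.finiteDimensional _ (c := c / (‖S‖ + 1)) (by positivity) ?_
    rintro _ ⟨x, rfl⟩
    have h1 := h x x.2
    have h2 := S.le_opNorm x
    rw [div_mul_eq_mul_div, div_le_iff₀ (by positivity)]
    simp only [ContinuousLinearMap.comp_apply] at h1
    change c * ‖S x‖ ≤ ‖T (S x)‖ * (‖S‖ + 1)
    nlinarith [norm_nonneg (x : X), norm_nonneg S, norm_nonneg (S x)]
  exact hM (LinearEquiv.finiteDimensional (LinearEquiv.ofInjective _ hinj).symm)

theorem IsStrictlySingular.smul {T : X →L[𝕜] Y} (hT : IsStrictlySingular T) (a : 𝕜) :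
    IsStrictlySingular (a • T) := by
  have := hT.comp_left (a • ContinuousLinearMap.id 𝕜 Y)
  convert this using 1
  ext x
  simp

theorem isStrictlySingular_zero : IsStrictlySingular (0 : X →L[𝕜] Y) := by
  rintro M - hM ⟨c, hc, h⟩
  have : M = ⊥ := by
    rw [Submodule.eq_bot_iff]
    intro x hx
    have h1 := h x hx
    simp only [zero_apply, norm_zero] at h1
    exact norm_eq_zero.1 (le_antisymm (by nlinarith) (norm_nonneg _))
  subst this
  exact hM inferInstance

theorem isClosed_setOf_isStrictlySingular :
    IsClosed {T : X →L[𝕜] Y | IsStrictlySingular T} := by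
  refine isClosed_of_closure_subset fun T hT M _ hM ⟨c, hc, h⟩ => ?_
  obtain ⟨S, hS, hd⟩ := Metric.mem_closure_iff.1 hT (c / 2) (by positivity)
  refine hM (IsStrictlySingular.finiteDimensional hS M (c := c / 2) (by positivity) fun x hx => ?_)
  have h1 := h x hx
  have h2 := (T - S).le_opNorm x
  rw [dist_eq_norm] at hd
  have h3 : ‖T x‖ ≤ ‖(T - S) x‖ + ‖S x‖ := by
    simpa using norm_add_le ((T - S) x) (S x)
  nlinarith [norm_nonneg x]

/-- Infinite-dimensional subspaces meet finitely many kernels in vectors on which a strictly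
singular operator is small. -/
theorem IsStrictlySingular.exists_norm_eq_one {T : X →L[𝕜] Y} (hT : IsStrictlySingular T)
    {M : Submodule 𝕜 X} (hM : ¬FiniteDimensional 𝕜 M) {ι : Type*} (s : Finset ι)
    (f : ι → X →L[𝕜] 𝕜) {ε : ℝ} (hε : 0 < ε) :
    ∃ x ∈ M, ‖x‖ = 1 ∧ (∀ i ∈ s, f i x = 0) ∧ ‖T x‖ ≤ ε := by
  let L : M →ₗ[𝕜] (s → 𝕜) := LinearMap.pi fun i => (f i : X →ₗ[𝕜] 𝕜) ∘ₗ M.subtype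
  have hker : ¬FiniteDimensional 𝕜 (LinearMap.ker L) := by
    intro h
    have : FiniteDimensional 𝕜 (M ⧸ LinearMap.ker L) :=
      LinearEquiv.finiteDimensional L.quotKerEquivRange.symm
    exact hM (Module.Finite.of_submodule_quotient (LinearMap.ker L))
  by_contra! hcon
  have hfd : FiniteDimensional 𝕜 ((LinearMap.ker L).map M.subtype) := by
    refine hT.finiteDimensional _ hε ?_
    rintro _ ⟨x, hx, rfl⟩
    have hx' : ∀ i ∈ s, f i x = 0 := fun i hi => congrFun (show L x = 0 from hx) ⟨i, hi⟩
    rcases eq_or_ne (x : X) 0 with h0 | h0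
    · simp [h0]
    have hn : (0 : ℝ) < ‖(x : X)‖ := norm_pos_iff.2 h0
    have := hcon (((‖(x : X)‖⁻¹ : ℝ) : 𝕜) • (x : X)) (M.smul_mem _ x.2)
      (by rw [norm_smul, RCLike.norm_ofReal, abs_of_pos (by positivity)]; field_simp)
      (fun i hi => by simp [hx' i hi])
    rw [map_smul, norm_smul, RCLike.norm_ofReal, abs_of_pos (by positivity),
      ← div_eq_inv_mul, lt_div_iff₀ hn] at this
    exact this.le
  exact hker (LinearEquiv.finiteDimensional
    (Submodule.equivMapOfInjective M.subtype M.injective_subtype (LinearMap.ker L)).symm)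

theorem norm_coeff_le_of_triangular {x : ℕ → X} {f : ℕ → X →L[𝕜] 𝕜} (hf : ∀ k, ‖f k‖ = 1)
    (hx : ∀ k, ‖x k‖ = 1) (hfx : ∀ k, f k (x k) = 1) (htri : ∀ m k, m < k → f m (x k) = 0)
    (n : ℕ) (a : ℕ → 𝕜) (k : ℕ) (hk : k < n) :
    ‖a k‖ ≤ 2 ^ k * ‖∑ i ∈ Finset.range n, a i • x i‖ := by
  induction k using Nat.strong_induction_on with
  | _ k ih =>
    set v := ∑ i ∈ Finset.range n, a i • x i with hv
    have h1 : f k v = ∑ i ∈ Finset.range k, a i * f k (x i) + a k := by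
      rw [hv, map_sum, ← Finset.sum_subset (Finset.range_subset_range.2 (Nat.succ_le_of_lt hk)),
        Finset.sum_range_succ]
      · simp [hfx]
      · intro i _ hi
        simp [htri k i (by simpa using hi)]
    have h2 : ‖f k v‖ ≤ ‖v‖ := by simpa [hf] using (f k).le_opNorm v
    have h3 : ‖∑ i ∈ Finset.range k, a i * f k (x i)‖ ≤ ∑ i ∈ Finset.range k, 2 ^ i * ‖v‖ := by
      refine (norm_sum_le _ _).trans (Finset.sum_le_sum fun i hi => ?_)
      have hik := Finset.mem_range.1 hi
      have h4 : ‖f k (x i)‖ ≤ 1 := by simpa [hf, hx] using (f k).le_opNorm (x i)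
      rw [norm_mul]
      exact (mul_le_of_le_one_right (norm_nonneg _) h4).trans (ih i hik (hik.trans hk))
    have h5 : ∑ i ∈ Finset.range k, (2 : ℝ) ^ i = 2 ^ k - 1 := by
      rw [geom_sum_eq (by norm_num)]; norm_num
    rw [← Finset.sum_mul, h5] at h3
    have h6 : a k = f k v - ∑ i ∈ Finset.range k, a i * f k (x i) := by rw [h1]; ring
    rw [h6]
    refine (norm_sub_le _ _).trans ?_
    linarith

theorem IsStrictlySingular.exists_submodule_le {T : X →L[𝕜] Y} (hT : IsStrictlySingular T)
    {M : Submodule 𝕜 X} (hM : ¬FiniteDimensional 𝕜 M) {ε : ℝ} (hε : 0 < ε) :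
    ∃ N ≤ M, ¬FiniteDimensional 𝕜 N ∧ ∀ x ∈ N, ‖T x‖ ≤ ε * ‖x‖ := by
  obtain ⟨F, hP, hr⟩ := exists_seq_of_forall_finset_exists
    (fun t : ℕ × X × (X →L[𝕜] 𝕜) => t.2.1 ∈ M ∧ ‖t.2.1‖ = 1 ∧ ‖t.2.2‖ = 1 ∧ t.2.2 t.2.1 = 1 ∧
      ‖T t.2.1‖ ≤ ε / 2 * (1 / 4) ^ t.1)
    (fun t t' => t.1 < t'.1 ∧ t.2.2 t'.2.1 = 0) (by
      intro s _
      obtain ⟨x, hxM, hx1, hxs, hxT⟩ := hT.exists_norm_eq_one hM s (fun t => t.2.2)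
        (ε := ε / 2 * (1 / 4) ^ (s.sup Prod.fst + 1)) (by positivity)
      obtain ⟨g, hg, hgx⟩ := exists_dual_vector 𝕜 x (by simp [hx1])
      exact ⟨(s.sup Prod.fst + 1, x, g), ⟨hxM, hx1, hg, by simp [hgx, hx1], hxT⟩, fun t ht =>
        ⟨Nat.lt_succ_of_le (Finset.le_sup (f := Prod.fst) ht), hxs t ht⟩⟩)
  have hmono : StrictMono fun k => (F k).1 := fun m n h => (hr m n h).1
  have hcoeff := norm_coeff_le_of_triangular (x := fun k => (F k).2.1) (f := fun k => (F k).2.2)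
    (fun k => (hP k).2.2.1) (fun k => (hP k).2.1) (fun k => (hP k).2.2.2.1)
    (fun m k h => (hr m k h).2)
  refine ⟨Submodule.span 𝕜 (Set.range fun k => (F k).2.1), ?_,
    not_finiteDimensional_span_range fun n a h0 k hk => ?_, fun x hx => ?_⟩
  · rw [Submodule.span_le]
    rintro _ ⟨k, rfl⟩
    exact (hP k).1
  · have := hcoeff n a k hk
    rw [h0] at this
    simpa using this
  · obtain ⟨n, a, rfl⟩ := exists_eq_sum_range_of_mem_span hx
    set v := ∑ k ∈ Finset.range n, a k • (F k).2.1 with hv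
    have hT' : ‖T v‖ ≤ ∑ k ∈ Finset.range n, ε * ‖v‖ * ((1 / 2) / 2 ^ k) := by
      rw [hv, map_sum]
      refine (norm_sum_le _ _).trans (Finset.sum_le_sum fun k hk => ?_)
      rw [map_smul, norm_smul, ← hv]
      have h1 := hcoeff n a k (Finset.mem_range.1 hk)
      have h2 : ‖T (F k).2.1‖ ≤ ε / 2 * (1 / 4) ^ k := (hP k).2.2.2.2.trans <|
        mul_le_mul_of_nonneg_left
          (pow_le_pow_of_le_one (by norm_num) (by norm_num) (hmono.id_le k)) (by positivity)
      calc ‖a k‖ * ‖T (F k).2.1‖ ≤ (2 ^ k * ‖v‖) * (ε / 2 * (1 / 4) ^ k) := by gcongr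
        _ = ε * ‖v‖ * ((1 / 2) / 2 ^ k) := by
          rw [show (1 / 4 : ℝ) = 1 / (2 * 2) by norm_num, div_pow, mul_pow, one_pow]
          field_simp
    refine hT'.trans ?_
    rw [← Finset.mul_sum]
    refine mul_le_of_le_one_right (by positivity) ?_
    have := (summable_geometric_two' (1 : ℝ)).sum_le_tsum (Finset.range n)
      (fun i _ => by positivity)
    rwa [tsum_geometric_two'] at this

theorem IsStrictlySingular.add {S T : X →L[𝕜] Y} (hS : IsStrictlySingular S)
    (hT : IsStrictlySingular T) : IsStrictlySingular (S + T) := by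
  rintro M - hM ⟨c, hc, h⟩
  obtain ⟨N, hNM, hN, hsmall⟩ := hS.exists_submodule_le hM (half_pos hc)
  refine hN (hT.finiteDimensional N (half_pos hc) fun x hx => ?_)
  have h1 := h x (hNM hx)
  have h2 := hsmall x hx
  have h3 := norm_add_le (S x) (T x)
  simp only [add_apply] at h1
  linarith

end StrictlySingular

section GlidingHump

variable {𝕜 X Y : Type*} [RCLike 𝕜] [NormedAddCommGroup X] [NormedSpace 𝕜 X]
  [NormedAddCommGroup Y] [NormedSpace 𝕜 Y]

/-- `R` is a sequence of nested commuting projections converging strongly to the identity. -/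
structure IsTruncation (R : ℕ → X →L[𝕜] X) : Prop where
  tendsto (x : X) : Tendsto (fun N => R N x) atTop (𝓝 x)
  apply_apply (M N : ℕ) (x : X) : R M (R N x) = R (min M N) x

theorem IsTruncation.exists_blocks {R : ℕ → X →L[𝕜] X} {S : ℕ → Y →L[𝕜] Y}
    (hR : IsTruncation R) (hS : IsTruncation S) {x : ℕ → X} {y : ℕ → Y}
    (hx : ∀ N, Tendsto (fun m => R N (x m)) atTop (𝓝 0))
    (hy : ∀ N, Tendsto (fun m => S N (y m)) atTop (𝓝 0)) {δ : ℕ → ℝ} (hδ : ∀ k, 0 < δ k) :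
    ∃ φ N : ℕ → ℕ, Monotone N ∧ ∀ k,
      ‖x (φ k) - (R (N (k + 1)) (x (φ k)) - R (N k) (x (φ k)))‖ ≤ δ k ∧
      ‖y (φ k) - (S (N (k + 1)) (y (φ k)) - S (N k) (y (φ k)))‖ ≤ δ k := by
  have key : ∀ k N, ∃ m N', N ≤ N' ∧ ‖x m - (R N' (x m) - R N (x m))‖ ≤ δ k ∧
      ‖y m - (S N' (y m) - S N (y m))‖ ≤ δ k := by
    intro k N
    have hpos : 0 < δ k / 2 := half_pos (hδ k)
    obtain ⟨m, hm1, hm2⟩ := (((Metric.tendsto_nhds.1 (hx N)) _ hpos).and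
      ((Metric.tendsto_nhds.1 (hy N)) _ hpos)).exists
    obtain ⟨N', ⟨h1, h2⟩, h3⟩ := ((((Metric.tendsto_nhds.1 (hR.tendsto (x m))) _ hpos).and
      ((Metric.tendsto_nhds.1 (hS.tendsto (y m))) _ hpos)).and (eventually_ge_atTop N)).exists
    rw [dist_zero_right] at hm1 hm2
    rw [dist_comm, dist_eq_norm] at h1 h2
    refine ⟨m, N', h3, ?_, ?_⟩
    · rw [← sub_add]
      linarith [norm_add_le (x m - R N' (x m)) (R N (x m))]
    · rw [← sub_add]
      linarith [norm_add_le (y m - S N' (y m)) (S N (y m))]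
  choose m N' hN h using key
  let N : ℕ → ℕ := fun k => Nat.rec 0 (fun k N => N' k N) k
  exact ⟨fun k => m k (N k), N, monotone_nat_of_le_succ fun k => hN k (N k), fun k => h k (N k)⟩

/-- Upper `p`-estimates on `W` for vectors that are separated by `R`. -/
def HasUpperEstimate (R : ℕ → X →L[𝕜] X) (W : Submodule 𝕜 X) (p : ℝ) : Prop :=
  ∀ N, ∀ u ∈ W, ∀ v ∈ W, R N u = u → R N v = 0 → ‖u + v‖ ^ p ≤ ‖u‖ ^ p + ‖v‖ ^ p

/-- Lower `p`-estimates for vectors that are separated by `R`. -/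
def HasLowerEstimate (R : ℕ → X →L[𝕜] X) (p : ℝ) : Prop :=
  ∀ N u v, R N u = u → R N v = 0 → ‖u‖ ^ p + ‖v‖ ^ p ≤ ‖u + v‖ ^ p

theorem HasUpperEstimate.sum_le {R : ℕ → X →L[𝕜] X} {W : Submodule 𝕜 X} {p : ℝ}
    (h : HasUpperEstimate R W p) (hp : 0 < p) {b : ℕ → X} (hb : ∀ k, b k ∈ W) {N : ℕ → ℕ}
    (h1 : ∀ k n, k < n → R (N n) (b k) = b k) (h2 : ∀ k, R (N k) (b k) = 0) (a : ℕ → 𝕜) (n : ℕ) :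
    ‖∑ k ∈ Finset.range n, a k • b k‖ ^ p ≤ ∑ k ∈ Finset.range n, (‖a k‖ * ‖b k‖) ^ p := by
  induction n with
  | zero => simp [Real.zero_rpow hp.ne']
  | succ n ih =>
    rw [Finset.sum_range_succ, Finset.sum_range_succ, ← norm_smul]
    refine (h (N n) _ (W.sum_mem fun k _ => W.smul_mem _ (hb k)) _ (W.smul_mem _ (hb n)) ?_ ?_).trans
      (by gcongr)
    · rw [map_sum]
      exact Finset.sum_congr rfl fun k hk => by rw [map_smul, h1 k n (Finset.mem_range.1 hk)]
    · rw [map_smul, h2, smul_zero]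

theorem HasLowerEstimate.le_sum {R : ℕ → X →L[𝕜] X} {p : ℝ}
    (h : HasLowerEstimate R p) (hp : 0 < p) {b : ℕ → X} {N : ℕ → ℕ}
    (h1 : ∀ k n, k < n → R (N n) (b k) = b k) (h2 : ∀ k, R (N k) (b k) = 0) (a : ℕ → 𝕜) (n : ℕ) :
    ∑ k ∈ Finset.range n, (‖a k‖ * ‖b k‖) ^ p ≤ ‖∑ k ∈ Finset.range n, a k • b k‖ ^ p := by
  induction n with
  | zero => simp [Real.zero_rpow hp.ne']
  | succ n ih =>
    rw [Finset.sum_range_succ, Finset.sum_range_succ, ← norm_smul]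
    refine le_trans (by gcongr) (h (N n) _ _ ?_ ?_)
    · rw [map_sum]
      exact Finset.sum_congr rfl fun k hk => by rw [map_smul, h1 k n (Finset.mem_range.1 hk)]
    · rw [map_smul, h2, smul_zero]

/-- The `ℓ^p`-norm of the first `n` terms of `a`. -/
def partialNorm (p : ℝ) (a : ℕ → 𝕜) (n : ℕ) : ℝ :=
  (∑ k ∈ Finset.range n, ‖a k‖ ^ p) ^ p⁻¹

theorem partialNorm_nonneg (p : ℝ) (a : ℕ → 𝕜) (n : ℕ) : 0 ≤ partialNorm p a n := by
  unfold partialNorm; positivity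

theorem partialNorm_rpow {p : ℝ} (hp : 0 < p) (a : ℕ → 𝕜) (n : ℕ) :
    partialNorm p a n ^ p = ∑ k ∈ Finset.range n, ‖a k‖ ^ p :=
  Real.rpow_inv_rpow (by positivity) hp.ne'

theorem norm_le_partialNorm {p : ℝ} (hp : 0 < p) (a : ℕ → 𝕜) {n k : ℕ} (hk : k < n) :
    ‖a k‖ ≤ partialNorm p a n := by
  rw [← Real.rpow_le_rpow_iff (norm_nonneg _) (partialNorm_nonneg p a n) hp, partialNorm_rpow hp]
  exact Finset.single_le_sum (f := fun k => ‖a k‖ ^ p) (fun i _ => by positivity)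
    (Finset.mem_range.2 hk)

theorem norm_sum_smul_sub_le {p : ℝ} (hp : 0 < p) {x b : ℕ → X} {δ : ℕ → ℝ} {D : ℝ}
    (hxb : ∀ k, ‖x k - b k‖ ≤ δ k) (hD : ∀ n, ∑ k ∈ Finset.range n, δ k ≤ D) (a : ℕ → 𝕜) (n : ℕ) :
    ‖∑ k ∈ Finset.range n, a k • x k - ∑ k ∈ Finset.range n, a k • b k‖ ≤
      D * partialNorm p a n := by
  rw [← Finset.sum_sub_distrib]
  calc _ ≤ ∑ k ∈ Finset.range n, δ k * partialNorm p a n := by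
        refine (norm_sum_le _ _).trans (Finset.sum_le_sum fun k hk => ?_)
        rw [← smul_sub, norm_smul, mul_comm]
        have := norm_le_partialNorm hp a (Finset.mem_range.1 hk)
        have := hxb k
        have := (norm_nonneg _).trans this
        gcongr
    _ ≤ _ := by
        rw [← Finset.sum_mul]
        exact mul_le_mul_of_nonneg_right (hD n) (partialNorm_nonneg p a n)

theorem IsTruncation.apply_block {R : ℕ → X →L[𝕜] X} (hR : IsTruncation R) {N : ℕ → ℕ}
    (hN : Monotone N) (x : X) (k n : ℕ) (hk : k < n) :
    R (N n) (R (N (k + 1)) x - R (N k) x) = R (N (k + 1)) x - R (N k) x := by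
  rw [map_sub, hR.apply_apply, hR.apply_apply, min_eq_right (hN hk), min_eq_right (hN hk.le)]

theorem IsTruncation.apply_block_self {R : ℕ → X →L[𝕜] X} (hR : IsTruncation R) {N : ℕ → ℕ}
    (hN : Monotone N) (x : X) (k : ℕ) : R (N k) (R (N (k + 1)) x - R (N k) x) = 0 := by
  rw [map_sub, hR.apply_apply, hR.apply_apply, min_eq_left (hN k.le_succ), min_self, sub_self]

/-- Gliding hump: two simultaneous sequences, one dominated by and one dominating a sequence
space basis. -/
theorem exists_subseq_estimates {R : ℕ → X →L[𝕜] X} {S : ℕ → Y →L[𝕜] Y}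
    (hR : IsTruncation R) (hS : IsTruncation S) {p q : ℝ} (hp : 0 < p) (hq : 0 < q)
    {W : Submodule 𝕜 X} (hRW : ∀ N, ∀ x ∈ W, R N x ∈ W)
    (hup : HasUpperEstimate R W p) (hlow : HasLowerEstimate S q) {x : ℕ → X} {y : ℕ → Y}
    (hx : ∀ N, Tendsto (fun m => R N (x m)) atTop (𝓝 0))
    (hy : ∀ N, Tendsto (fun m => S N (y m)) atTop (𝓝 0))
    (hxW : ∀ m, x m ∈ W) {C ε : ℝ} (hxC : ∀ m, ‖x m‖ ≤ C) (hε : 0 < ε) (hyε : ∀ m, ε ≤ ‖y m‖) :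
    ∃ φ : ℕ → ℕ, ∃ C' > 0, ∃ c > 0, ∀ (n : ℕ) (a : ℕ → 𝕜),
      ‖∑ k ∈ Finset.range n, a k • x (φ k)‖ ≤ C' * partialNorm p a n ∧
      c * partialNorm q a n ≤ ‖∑ k ∈ Finset.range n, a k • y (φ k)‖ := by
  set δ : ℕ → ℝ := fun k => ε / 4 / 2 / 2 ^ k with hδ
  have hD : ∀ n, ∑ k ∈ Finset.range n, δ k ≤ ε / 4 := fun n => by
    have := (summable_geometric_two' (ε / 4)).sum_le_tsum (Finset.range n)
      (fun i _ => by positivity)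
    rwa [tsum_geometric_two'] at this
  have hδle : ∀ k, δ k ≤ ε / 4 := fun k =>
    (Finset.single_le_sum (fun i _ => by positivity) (Finset.self_mem_range_succ k)).trans
      (hD (k + 1))
  obtain ⟨φ, N, hN, h⟩ := hR.exists_blocks hS hx hy (δ := δ) (fun k => by positivity)
  have hC : 0 ≤ C := (norm_nonneg _).trans (hxC 0)
  refine ⟨φ, C + ε / 4 + ε / 4, by positivity, ε / 2 - ε / 4, by linarith, fun n a => ⟨?_, ?_⟩⟩
  · set b : ℕ → X := fun k => R (N (k + 1)) (x (φ k)) - R (N k) (x (φ k)) with hb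
    have h1 := norm_sum_smul_sub_le (x := fun k => x (φ k)) (b := b) hp (fun k => (h k).1) hD a n
    have hbn : ∀ k, ‖b k‖ ≤ C + ε / 4 := fun k => by
      have := norm_sub_le (x (φ k)) (x (φ k) - b k)
      rw [sub_sub_cancel] at this
      linarith [hxC (φ k), hδle k, (h k).1]
    have h2 : ‖∑ k ∈ Finset.range n, a k • b k‖ ≤ (C + ε / 4) * partialNorm p a n := by
      rw [← Real.rpow_le_rpow_iff (norm_nonneg _)
        (mul_nonneg (by positivity) (partialNorm_nonneg p a n)) hp,
        Real.mul_rpow (by positivity) (partialNorm_nonneg p a n), partialNorm_rpow hp]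
      refine (hup.sum_le hp (N := N) (fun k => W.sub_mem (hRW _ _ (hxW _)) (hRW _ _ (hxW _)))
        (fun k n hk => hR.apply_block hN _ k n hk) (fun k => hR.apply_block_self hN _ k) a n).trans ?_
      rw [Finset.mul_sum]
      refine Finset.sum_le_sum fun k _ => ?_
      rw [Real.mul_rpow (norm_nonneg _) (norm_nonneg _), mul_comm]
      have := hbn k
      gcongr
    have := norm_add_le (∑ k ∈ Finset.range n, a k • x (φ k) - ∑ k ∈ Finset.range n, a k • b k)
      (∑ k ∈ Finset.range n, a k • b k)
    rw [sub_add_cancel] at this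
    linarith
  · set b : ℕ → Y := fun k => S (N (k + 1)) (y (φ k)) - S (N k) (y (φ k)) with hb
    have h1 := norm_sum_smul_sub_le (x := fun k => y (φ k)) (b := b) hq (fun k => (h k).2) hD a n
    have hbn : ∀ k, ε / 2 ≤ ‖b k‖ := fun k => by
      have := norm_add_le (y (φ k) - b k) (b k)
      rw [sub_add_cancel] at this
      linarith [hyε (φ k), hδle k, (h k).2]
    have h2 : (ε / 2) * partialNorm q a n ≤ ‖∑ k ∈ Finset.range n, a k • b k‖ := by
      rw [← Real.rpow_le_rpow_iff (mul_nonneg (by positivity) (partialNorm_nonneg q a n))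
        (norm_nonneg _) hq, Real.mul_rpow (by positivity) (partialNorm_nonneg q a n),
        partialNorm_rpow hq]
      refine le_trans ?_ (hlow.le_sum hq (N := N)
        (fun k n hk => hS.apply_block hN _ k n hk) (fun k => hS.apply_block_self hN _ k) a n)
      rw [Finset.mul_sum]
      refine Finset.sum_le_sum fun k _ => ?_
      rw [Real.mul_rpow (norm_nonneg _) (norm_nonneg _), mul_comm]
      have := hbn k
      gcongr
    have := norm_sub_norm_le (∑ k ∈ Finset.range n, a k • b k)
      (∑ k ∈ Finset.range n, a k • y (φ k))
    rw [norm_sub_rev] at this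
    linarith

end GlidingHump

section SequenceSpaces

variable {𝕜 : Type*} [RCLike 𝕜]

theorem toReal_pos_of_one_le {q : ℝ≥0∞} [hq : Fact (1 ≤ q)] (hq' : q ≠ ∞) : 0 < q.toReal :=
  ENNReal.toReal_pos (zero_lt_one.trans_le hq.out).ne' hq'

/-- The projection of `ℓ^q` onto the first `N` coordinates. -/
def lpTrunc (𝕜 : Type*) [RCLike 𝕜] (q : ℝ≥0∞) [Fact (1 ≤ q)] (N : ℕ) :
    lp (fun _ : ℕ => 𝕜) q →L[𝕜] lp (fun _ : ℕ => 𝕜) q :=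
  ∑ i ∈ Finset.range N,
    lp.singleContinuousLinearMap 𝕜 (fun _ : ℕ => 𝕜) q i ∘L lp.evalCLM 𝕜 (fun _ : ℕ => 𝕜) q i

variable {q q' : ℝ≥0∞} [Fact (1 ≤ q)] [Fact (1 ≤ q')]

theorem lpTrunc_eq_sum (N : ℕ) (x : lp (fun _ : ℕ => 𝕜) q) :
    lpTrunc 𝕜 q N x = ∑ i ∈ Finset.range N, lp.single q i (x i) := by
  simp only [lpTrunc, sum_apply]
  rfl

theorem lpTrunc_apply (N : ℕ) (x : lp (fun _ : ℕ => 𝕜) q) (i : ℕ) :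
    lpTrunc 𝕜 q N x i = if i < N then x i else 0 := by
  rw [lpTrunc_eq_sum, lp.coeFn_sum, Finset.sum_apply]
  simp [Pi.single_apply]

theorem tendsto_lpTrunc_zero {x : ℕ → lp (fun _ : ℕ => 𝕜) q}
    (hx : ∀ i, Tendsto (fun m => x m i) atTop (𝓝 0)) (N : ℕ) :
    Tendsto (fun m => lpTrunc 𝕜 q N (x m)) atTop (𝓝 0) := by
  simp only [lpTrunc_eq_sum]
  rw [← Finset.sum_const_zero (s := Finset.range N)]
  refine tendsto_finsetSum _ fun i _ => ?_
  have := ((lp.singleContinuousLinearMap 𝕜 (fun _ : ℕ => 𝕜) q i).continuous.tendsto 0).comp (hx i)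
  rwa [map_zero] at this

theorem isTruncation_lpTrunc (hq : q ≠ ∞) : IsTruncation (lpTrunc 𝕜 q) where
  tendsto x := by
    simp only [lpTrunc_eq_sum]
    exact (lp.hasSum_single hq x).tendsto_sum_nat
  apply_apply M N x := by
    ext i
    simp only [lpTrunc_apply, lt_min_iff]
    split_ifs <;> tauto

theorem norm_rpow_add_of_lpTrunc (hq : q ≠ ∞) {N : ℕ} {u v : lp (fun _ : ℕ => 𝕜) q}
    (hu : lpTrunc 𝕜 q N u = u) (hv : lpTrunc 𝕜 q N v = 0) :
    ‖u + v‖ ^ q.toReal = ‖u‖ ^ q.toReal + ‖v‖ ^ q.toReal := by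
  have h0 := toReal_pos_of_one_le hq
  refine (lp.hasSum_norm h0 (u + v)).unique ?_
  convert (lp.hasSum_norm h0 u).add (lp.hasSum_norm h0 v) using 2 with i
  by_cases hi : i < N
  · have : v i = 0 := by
      have := lpTrunc_apply N v i
      rw [hv, if_pos hi] at this
      exact this.symm
    simp [this, Real.zero_rpow h0.ne']
  · have : u i = 0 := by
      have := lpTrunc_apply N u i
      rwa [hu, if_neg hi] at this
    simp [this, Real.zero_rpow h0.ne']

theorem hasLowerEstimate_lpTrunc (hq : q ≠ ∞) : HasLowerEstimate (lpTrunc 𝕜 q) q.toReal :=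
  fun _ _ _ hu hv => (norm_rpow_add_of_lpTrunc hq hu hv).ge

theorem hasUpperEstimate_lpTrunc (hq : q ≠ ∞) : HasUpperEstimate (lpTrunc 𝕜 q) ⊤ q.toReal :=
  fun _ _ _ _ _ hu hv => (norm_rpow_add_of_lpTrunc hq hu hv).le

theorem memℓp_comp_of_injective {s : ℝ≥0∞} (hq : q ≠ ∞) (h : q ≤ s) {g : ℕ → ℕ}
    (hg : Function.Injective g) (x : lp (fun _ : ℕ => 𝕜) q) : Memℓp (fun i => x (g i)) s := by
  refine Memℓp.of_exponent_ge (memℓp_gen ?_) h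
  exact ((lp.memℓp x).summable (toReal_pos_of_one_le hq)).comp_injective hg

/-- The operator `(x_i) ↦ (x_{g i})` from `ℓ^q` to `ℓ^{q'}` for an injective map `g`. -/
def lpComp (𝕜 : Type*) [RCLike 𝕜] {q q' : ℝ≥0∞} [Fact (1 ≤ q)] [Fact (1 ≤ q')] (hq : q ≠ ∞)
    (h : q ≤ q') (g : ℕ → ℕ) (hg : Function.Injective g) :
    lp (fun _ : ℕ => 𝕜) q →L[𝕜] lp (fun _ : ℕ => 𝕜) q' where
  toFun x := ⟨fun i => x (g i), memℓp_comp_of_injective hq h hg x⟩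
  map_add' _ _ := rfl
  map_smul' _ _ := rfl
  cont := by
    let L : lp (fun _ : ℕ => 𝕜) q →ₗ[𝕜] lp (fun _ : ℕ => 𝕜) q' :=
      { toFun := fun x => ⟨fun i => x (g i), memℓp_comp_of_injective hq h hg x⟩
        map_add' := fun _ _ => rfl
        map_smul' := fun _ _ => rfl }
    refine L.continuous_of_seq_closed_graph fun u x y hu hy => lp.ext (funext fun i => ?_)
    have h1 := ((lp.evalCLM 𝕜 (fun _ : ℕ => 𝕜) q (g i)).continuous.tendsto x).comp hu
    have h2 := ((lp.evalCLM 𝕜 (fun _ : ℕ => 𝕜) q' i).continuous.tendsto y).comp hy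
    exact tendsto_nhds_unique h2 h1

theorem lpComp_apply (hq : q ≠ ∞) (h : q ≤ q') (g : ℕ → ℕ) (hg : Function.Injective g)
    (x : lp (fun _ : ℕ => 𝕜) q) (i : ℕ) : lpComp 𝕜 hq h g hg x i = x (g i) := rfl

theorem lpComp_single (hq : q ≠ ∞) (h : q ≤ q') (g : ℕ → ℕ) (hg : Function.Injective g)
    (i : ℕ) (a : 𝕜) : lpComp 𝕜 hq h g hg (lp.single q (g i) a) = lp.single q' i a := by
  ext j
  rw [lpComp_apply]
  simp [Pi.single_apply, hg.eq_iff]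

theorem lpComp_single_of_notMem (hq : q ≠ ∞) (h : q ≤ q') (g : ℕ → ℕ) (hg : Function.Injective g)
    {k : ℕ} (hk : ∀ i, g i ≠ k) (a : 𝕜) : lpComp 𝕜 hq h g hg (lp.single q k a) = 0 := by
  ext j
  rw [lpComp_apply]
  simp [hk]

theorem isStrictlySingular_lpComp (hq : q ≠ ∞) (hq' : q' ≠ ∞) (h : q < q') (g : ℕ → ℕ)
    (hg : Function.Injective g) : IsStrictlySingular (lpComp 𝕜 hq h.le g hg) := by
  rintro M - hM ⟨c, hc, hcM⟩
  set T := lpComp 𝕜 hq h.le g hg with hT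
  have h0 := toReal_pos_of_one_le hq
  have h0' := toReal_pos_of_one_le hq'
  choose z hzM hz1 hz0 _ using fun m : ℕ =>
    (isStrictlySingular_zero (𝕜 := 𝕜) (X := lp (fun _ : ℕ => 𝕜) q) (Y := 𝕜)).exists_norm_eq_one hM
      (Finset.range m) (fun i => lp.evalCLM 𝕜 (fun _ : ℕ => 𝕜) q i) one_pos
  have hz : ∀ i, Tendsto (fun m => z m i) atTop (𝓝 0) := fun i =>
    tendsto_const_nhds.congr' <| by
      filter_upwards [eventually_gt_atTop i] with m hm
      exact (hz0 m i (Finset.mem_range.2 hm)).symm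
  obtain ⟨φ, C, hC, d, hd, hest⟩ := exists_subseq_estimates (isTruncation_lpTrunc hq')
    (isTruncation_lpTrunc hq) h0' h0 (W := ⊤) (fun _ _ _ => trivial)
    (hasUpperEstimate_lpTrunc hq') (hasLowerEstimate_lpTrunc hq) (x := fun m => T (z m)) (y := z)
    (tendsto_lpTrunc_zero fun i => hz (g i)) (tendsto_lpTrunc_zero hz) (fun _ => trivial)
    (C := ‖T‖) (fun m => by simpa [hz1] using T.le_opNorm (z m)) one_pos (fun m => (hz1 m).ge)
  have hpn : ∀ (s : ℝ) (n : ℕ), partialNorm s (fun _ : ℕ => (1 : 𝕜)) n = (n : ℝ) ^ s⁻¹ := by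
    intro s n
    simp [partialNorm]
  have key : ∀ n : ℕ, c * d * (n : ℝ) ^ q.toReal⁻¹ ≤ C * (n : ℝ) ^ q'.toReal⁻¹ := by
    intro n
    obtain ⟨h1, h2⟩ := hest n fun _ => 1
    rw [hpn] at h1 h2
    have h3 := hcM (∑ k ∈ Finset.range n, (1 : 𝕜) • z (φ k))
      (M.sum_mem fun k _ => M.smul_mem _ (hzM _))
    simp only [map_sum, map_smul] at h3
    calc c * d * (n : ℝ) ^ q.toReal⁻¹ = c * (d * (n : ℝ) ^ q.toReal⁻¹) := by ring
      _ ≤ _ := (mul_le_mul_of_nonneg_left h2 hc.le).trans (h3.trans h1)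
  have hlt : q'.toReal⁻¹ < q.toReal⁻¹ := by
    have := (ENNReal.toReal_lt_toReal hq hq').2 h
    gcongr
  have htend := (tendsto_rpow_atTop (sub_pos.2 hlt)).comp tendsto_natCast_atTop_atTop
  obtain ⟨n, hn, hn0⟩ := ((htend.eventually_gt_atTop (C / (c * d))).and
    (eventually_gt_atTop 0)).exists
  have hn0' : (0 : ℝ) < n := by exact_mod_cast hn0
  have hk := key n
  simp only [Function.comp_apply] at hn
  rw [Real.rpow_sub hn0', div_lt_div_iff₀ (by positivity) (by positivity)] at hn
  linarith

theorem tendsto_apply_single (hq : 1 < q) (hq' : q ≠ ∞) (f : lp (fun _ : ℕ => 𝕜) q →L[𝕜] 𝕜) :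
    Tendsto (fun m => f (lp.single q m 1)) atTop (𝓝 0) := by
  have h0 := toReal_pos_of_one_le hq'
  have h1 : 1 < q.toReal := by
    simpa using (ENNReal.toReal_lt_toReal ENNReal.one_ne_top hq').2 hq
  rw [← Nat.cofinite_eq_atTop, Metric.tendsto_nhds]
  intro ε hε
  rw [Filter.eventually_cofinite]
  by_contra hinf
  have key : ∀ n : ℕ, (n : ℝ) * ε ≤ ‖f‖ * (n : ℝ) ^ q.toReal⁻¹ := by
    intro n
    obtain ⟨s, hs, rfl⟩ := Set.Infinite.exists_subset_card_eq hinf n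
    set a : ℕ → 𝕜 := fun i => (starRingEnd 𝕜) (f (lp.single q i 1)) / ‖f (lp.single q i 1)‖ with ha
    have hne : ∀ i ∈ s, ε ≤ ‖f (lp.single q i 1)‖ := fun i hi => by simpa using hs hi
    have hfa : f (∑ i ∈ s, lp.single q i (a i)) = ((∑ i ∈ s, ‖f (lp.single q i 1)‖ : ℝ) : 𝕜) := by
      rw [map_sum]
      push_cast
      refine Finset.sum_congr rfl fun i hi => ?_
      have h2 : (‖f (lp.single q i 1)‖ : 𝕜) ≠ 0 := by
        have := hne i hi
        exact_mod_cast (hε.trans_le this).ne'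
      have h3 : lp.single (E := fun _ : ℕ => 𝕜) q i (a i) = a i • lp.single q i 1 := by
        rw [← lp.single_smul, smul_eq_mul, mul_one]
      rw [h3, map_smul, smul_eq_mul, ha]
      simp only
      rw [div_mul_eq_mul_div, RCLike.conj_mul, div_eq_iff h2, sq]
    have hna : ∀ i ∈ s, ‖a i‖ = 1 := fun i hi => by
      have := hε.trans_le (hne i hi)
      rw [ha]
      simp [this.ne']
    have hnorm : ‖∑ i ∈ s, lp.single (E := fun _ : ℕ => 𝕜) q i (a i)‖ = (s.card : ℝ) ^ q.toReal⁻¹ := by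
      rw [Real.eq_rpow_inv (norm_nonneg _) (by positivity) h0.ne', lp.norm_sum_single h0,
        Finset.sum_congr rfl fun i hi => by rw [hna i hi, Real.one_rpow]]
      simp
    have h4 := f.le_opNorm (∑ i ∈ s, lp.single q i (a i))
    rw [hfa, hnorm, RCLike.norm_ofReal, abs_of_nonneg (by positivity)] at h4
    refine le_trans ?_ h4
    rw [← nsmul_eq_mul]
    exact Finset.card_nsmul_le_sum _ _ _ hne
  have hlt : q.toReal⁻¹ < 1 := inv_lt_one_of_one_lt₀ h1
  have htend := (tendsto_rpow_atTop (sub_pos.2 hlt)).comp tendsto_natCast_atTop_atTop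
  obtain ⟨n, hn, hn0⟩ := ((htend.eventually_gt_atTop (‖f‖ / ε)).and
    (eventually_gt_atTop 0)).exists
  have hn0' : (0 : ℝ) < n := by exact_mod_cast hn0
  have hk := key n
  simp only [Function.comp_apply] at hn
  rw [Real.rpow_sub hn0', div_lt_div_iff₀ (by positivity) (by positivity), Real.rpow_one] at hn
  linarith

end SequenceSpaces

section Sums

variable {𝕜 : Type*} [RCLike 𝕜] {X : Type*} [NormedAddCommGroup X] [NormedSpace 𝕜 X]

/-- `X` is a direct sum of the spaces `ℓ^{p_j}`, with projections `π` and inclusions `ι`, whose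
norm satisfies upper `p_j`-estimates for all `j`. -/
structure IsLpSum (p : ℕ → ℝ≥0∞) [∀ j, Fact (1 ≤ p j)]
    (π : ∀ j, X →L[𝕜] lp (fun _ : ℕ => 𝕜) (p j))
    (ι : ∀ j, lp (fun _ : ℕ => 𝕜) (p j) →L[𝕜] X) : Prop where
  proj_incl (j : ℕ) (y : lp (fun _ : ℕ => 𝕜) (p j)) : π j (ι j y) = y
  proj_incl_ne {j k : ℕ} (h : k ≠ j) (y : lp (fun _ : ℕ => 𝕜) (p j)) : π k (ι j y) = 0
  tendsto (x : X) : Tendsto (fun K => ∑ j ∈ Finset.range K, ι j (π j x)) atTop (𝓝 x)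
  upper (j : ℕ) (x u v : X) (h : ∀ k, ‖π k x‖ ^ (p j).toReal ≤
    ‖π k u‖ ^ (p j).toReal + ‖π k v‖ ^ (p j).toReal) :
    ‖x‖ ^ (p j).toReal ≤ ‖u‖ ^ (p j).toReal + ‖v‖ ^ (p j).toReal

variable {p : ℕ → ℝ≥0∞} [∀ j, Fact (1 ≤ p j)] {π : ∀ j, X →L[𝕜] lp (fun _ : ℕ => 𝕜) (p j)}
  {ι : ∀ j, lp (fun _ : ℕ => 𝕜) (p j) →L[𝕜] X}

theorem norm_lpTrunc_le {q : ℝ≥0∞} [Fact (1 ≤ q)] (hq : q ≠ ∞) (N : ℕ)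
    (y : lp (fun _ : ℕ => 𝕜) q) : ‖lpTrunc 𝕜 q N y‖ ≤ ‖y‖ := by
  have h0 := toReal_pos_of_one_le hq
  have hT := isTruncation_lpTrunc (𝕜 := 𝕜) hq
  have := norm_rpow_add_of_lpTrunc hq (N := N) (u := lpTrunc 𝕜 q N y)
    (v := y - lpTrunc 𝕜 q N y) (by rw [hT.apply_apply, min_self])
    (by rw [map_sub, hT.apply_apply, min_self, sub_self])
  rw [add_sub_cancel] at this
  rw [← Real.rpow_le_rpow_iff (norm_nonneg _) (norm_nonneg _) h0, this]
  have : 0 ≤ ‖y - lpTrunc 𝕜 q N y‖ ^ q.toReal := by positivity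
  linarith

/-- The projection onto the first `N` coordinates of the first `N` summands. -/
def sumTrunc (π : ∀ j, X →L[𝕜] lp (fun _ : ℕ => 𝕜) (p j))
    (ι : ∀ j, lp (fun _ : ℕ => 𝕜) (p j) →L[𝕜] X) (N : ℕ) : X →L[𝕜] X :=
  ∑ j ∈ Finset.range N, ι j ∘L lpTrunc 𝕜 (p j) N ∘L π j

theorem sumTrunc_apply (N : ℕ) (x : X) :
    sumTrunc π ι N x = ∑ j ∈ Finset.range N, ι j (lpTrunc 𝕜 (p j) N (π j x)) := by
  simp [sumTrunc, sum_apply]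

namespace IsLpSum

theorem norm_le (h : IsLpSum p π ι) (hp : ∀ j, p j ≠ ∞) {x y : X}
    (hxy : ∀ k, ‖π k x‖ ≤ ‖π k y‖) : ‖x‖ ≤ ‖y‖ := by
  have h0 := toReal_pos_of_one_le (hp 0)
  rw [← Real.rpow_le_rpow_iff (norm_nonneg _) (norm_nonneg _) h0]
  have := h.upper 0 x y 0 fun k => by
    have := hxy k
    rw [map_zero, norm_zero, Real.zero_rpow h0.ne', add_zero]
    gcongr
  rwa [norm_zero, Real.zero_rpow h0.ne', add_zero] at this

theorem ext (h : IsLpSum p π ι) (hp : ∀ j, p j ≠ ∞) {x y : X}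
    (hxy : ∀ k, π k x = π k y) : x = y := by
  have := h.norm_le hp (x := x - y) (y := 0) fun k => by simp [hxy k]
  rw [norm_zero] at this
  exact sub_eq_zero.1 (norm_eq_zero.1 (le_antisymm this (norm_nonneg _)))

theorem proj_sum_incl (h : IsLpSum p π ι) (y : ∀ j, lp (fun _ : ℕ => 𝕜) (p j)) (n k : ℕ) :
    π k (∑ j ∈ Finset.range n, ι j (y j)) = if k < n then y k else 0 := by
  rw [map_sum]
  split_ifs with hk
  · rw [Finset.sum_eq_single_of_mem k (Finset.mem_range.2 hk) fun j _ hj =>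
      h.proj_incl_ne hj.symm _, h.proj_incl]
  · exact Finset.sum_eq_zero fun j hj =>
      h.proj_incl_ne (by rintro rfl; exact hk (Finset.mem_range.1 hj)) _

theorem proj_sumTrunc (h : IsLpSum p π ι) (N k : ℕ) (x : X) :
    π k (sumTrunc π ι N x) = if k < N then lpTrunc 𝕜 (p k) N (π k x) else 0 := by
  rw [sumTrunc_apply, h.proj_sum_incl (fun j => lpTrunc 𝕜 (p j) N (π j x))]

theorem norm_sumTrunc_le (h : IsLpSum p π ι) (hp : ∀ j, p j ≠ ∞) (N : ℕ) (x : X) :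
    ‖sumTrunc π ι N x‖ ≤ ‖x‖ := by
  refine h.norm_le hp fun k => ?_
  rw [h.proj_sumTrunc]
  split_ifs
  · exact norm_lpTrunc_le (hp k) N _
  · simp

theorem isTruncation (h : IsLpSum p π ι) (hp : ∀ j, p j ≠ ∞) :
    IsTruncation (sumTrunc π ι) where
  tendsto x := by
    have hK : ∀ K, Tendsto (fun N => sumTrunc π ι N (∑ j ∈ Finset.range K, ι j (π j x))) atTop
        (𝓝 (∑ j ∈ Finset.range K, ι j (π j x))) := by
      intro K
      simp only [map_sum]
      refine tendsto_finsetSum _ fun j _ => ?_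
      have := ((ι j).continuous.tendsto _).comp
        ((isTruncation_lpTrunc (𝕜 := 𝕜) (hp j)).tendsto (π j x))
      refine this.congr' ?_
      filter_upwards [eventually_gt_atTop j] with N hN
      refine h.ext hp fun k => ?_
      rw [h.proj_sumTrunc, Function.comp_apply]
      rcases eq_or_ne k j with rfl | hkj
      · rw [if_pos hN, h.proj_incl, h.proj_incl]
      · simp [h.proj_incl_ne hkj]
    rw [Metric.tendsto_nhds]
    intro ε hε
    obtain ⟨K, hKx⟩ := (Metric.tendsto_nhds.1 (h.tendsto x) (ε / 3) (by positivity)).exists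
    filter_upwards [Metric.tendsto_nhds.1 (hK K) (ε / 3) (by positivity)] with N hN
    set y := ∑ j ∈ Finset.range K, ι j (π j x)
    have h1 : dist (sumTrunc π ι N x) (sumTrunc π ι N y) ≤ dist x y := by
      rw [dist_eq_norm, dist_eq_norm, ← map_sub]
      exact h.norm_sumTrunc_le hp N _
    rw [dist_comm] at hKx
    have h2 := dist_triangle4 (sumTrunc π ι N x) (sumTrunc π ι N y) y x
    rw [dist_comm y x] at h2
    linarith
  apply_apply M N x := by
    refine h.ext hp fun k => ?_
    simp only [h.proj_sumTrunc, lt_min_iff]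
    by_cases hM : k < M <;> by_cases hN : k < N <;>
      simp [hM, hN, (isTruncation_lpTrunc (𝕜 := 𝕜) (hp k)).apply_apply]

/-- The subspace of vectors supported on the summands from the `j`-th one on. -/
def tail (π : ∀ j, X →L[𝕜] lp (fun _ : ℕ => 𝕜) (p j)) (j : ℕ) : Submodule 𝕜 X :=
  ⨅ i ∈ Finset.range j, LinearMap.ker (π i : X →ₗ[𝕜] lp (fun _ : ℕ => 𝕜) (p i))

theorem mem_tail {j : ℕ} {x : X} : x ∈ tail π j ↔ ∀ i < j, π i x = 0 := by
  simp [tail, Submodule.mem_iInf]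

theorem sumTrunc_mem_tail (h : IsLpSum p π ι) {j : ℕ} (N : ℕ) (x : X) (hx : x ∈ tail π j) :
    sumTrunc π ι N x ∈ tail π j := by
  rw [mem_tail] at *
  intro i hi
  rw [h.proj_sumTrunc, hx i hi, map_zero, ite_self]

theorem hasUpperEstimate (h : IsLpSum p π ι) (hp : ∀ j, p j ≠ ∞) (hmono : StrictMono p) (j : ℕ) :
    HasUpperEstimate (sumTrunc π ι) (tail π j) (p j).toReal := by
  intro N u hu v hv huN hvN
  rw [mem_tail] at hu hv
  have h0 := toReal_pos_of_one_le (hp j)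
  refine h.upper j _ u v fun k => ?_
  rw [map_add]
  rcases lt_or_ge k j with hk | hk
  · simp [hu k hk, hv k hk, Real.zero_rpow h0.ne']
  by_cases hkN : k < N
  · have hku := h.proj_sumTrunc N k u
    have hkv := h.proj_sumTrunc N k v
    rw [huN, if_pos hkN] at hku
    rw [hvN, map_zero, if_pos hkN] at hkv
    have hk0 := toReal_pos_of_one_le (hp k)
    have hjk : (p j).toReal ≤ (p k).toReal :=
      (ENNReal.toReal_le_toReal (hp j) (hp k)).2 (hmono.monotone hk)
    have h1 := norm_rpow_add_of_lpTrunc (hp k) hku.symm hkv.symm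
    set a := ‖π k u‖
    set b := ‖π k v‖
    have ha : 0 ≤ a := norm_nonneg _
    have hb : 0 ≤ b := norm_nonneg _
    have h2 := Real.rpow_add_rpow_le_add (a := a ^ (p j).toReal) (b := b ^ (p j).toReal)
      (by positivity) (by positivity) ((one_le_div h0).2 hjk)
    rw [← Real.rpow_mul ha, ← Real.rpow_mul hb, mul_div_cancel₀ _ h0.ne', ← h1,
      one_div_div, ← Real.rpow_mul (norm_nonneg _), mul_div_cancel₀ _ hk0.ne'] at h2
    exact h2
  · have hku := h.proj_sumTrunc N k u
    rw [huN, if_neg hkN] at hku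
    rw [hku, zero_add]
    have : 0 ≤ ‖(0 : lp (fun _ : ℕ => 𝕜) (p k))‖ ^ (p j).toReal := by positivity
    linarith

theorem tendsto_sumTrunc_zero {x : ℕ → X}
    (hx : ∀ f : X →L[𝕜] 𝕜, Tendsto (fun m => f (x m)) atTop (𝓝 0)) (N : ℕ) :
    Tendsto (fun m => sumTrunc π ι N (x m)) atTop (𝓝 0) := by
  simp only [sumTrunc_apply]
  rw [← Finset.sum_const_zero (s := Finset.range N)]
  refine tendsto_finsetSum _ fun j _ => ?_
  have h1 : Tendsto (fun m => lpTrunc 𝕜 (p j) N (π j (x m))) atTop (𝓝 0) :=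
    tendsto_lpTrunc_zero (fun i => hx (lp.evalCLM 𝕜 (fun _ : ℕ => 𝕜) (p j) i ∘L π j)) N
  have := ((ι j).continuous.tendsto 0).comp h1
  rwa [map_zero] at this

/-- A Pitt-type theorem: strictly singular operators from the `j`-th tail to the `j`-th summand
are completely continuous. -/
theorem tendsto_proj_of_mem_tail (h : IsLpSum p π ι) (hp : ∀ j, p j ≠ ∞) (hmono : StrictMono p)
    {S : X →L[𝕜] X} (hS : IsStrictlySingular S) {j : ℕ} {z : ℕ → X}
    (hz : ∀ f : X →L[𝕜] 𝕜, Tendsto (fun m => f (z m)) atTop (𝓝 0)) {C : ℝ} (hC : ∀ m, ‖z m‖ ≤ C)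
    (hzj : ∀ m, z m ∈ tail π j) : Tendsto (fun m => π j (S (z m))) atTop (𝓝 0) := by
  have h0 := toReal_pos_of_one_le (hp j)
  by_contra hcon
  rw [Metric.tendsto_atTop] at hcon
  push Not at hcon
  obtain ⟨ε, hε, hcon⟩ := hcon
  choose ψ hψ hψε using hcon
  have hψt : Tendsto ψ atTop atTop := tendsto_atTop_mono hψ tendsto_id
  obtain ⟨φ, C', hC', c, hc, hest⟩ := exists_subseq_estimates (h.isTruncation hp)
    (isTruncation_lpTrunc (𝕜 := 𝕜) (hp j)) h0 h0 (W := tail π j) h.sumTrunc_mem_tail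
    (h.hasUpperEstimate hp hmono j) (hasLowerEstimate_lpTrunc (hp j)) (x := fun m => z (ψ m))
    (y := fun m => π j (S (z (ψ m)))) (fun N => (tendsto_sumTrunc_zero hz N).comp hψt)
    (tendsto_lpTrunc_zero fun i =>
      (hz (lp.evalCLM 𝕜 (fun _ : ℕ => 𝕜) (p j) i ∘L π j ∘L S)).comp hψt)
    (fun m => hzj _) (fun m => hC _) hε (fun m => by simpa using hψε m)
  have hmap : ∀ (n : ℕ) (a : ℕ → 𝕜), ∑ k ∈ Finset.range n, a k • π j (S (z (ψ (φ k)))) =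
      π j (S (∑ k ∈ Finset.range n, a k • z (ψ (φ k)))) := fun n a => by simp
  simp only [hmap] at hest
  refine not_finiteDimensional_span_range (𝕜 := 𝕜) (x := fun k => z (ψ (φ k)))
    (fun n a h0' k hk => ?_) (hS.finiteDimensional _ (c := c / (C' * (‖π j‖ + 1)))
      (by positivity) fun x hx => ?_)
  · have h1 := (hest n a).2
    rw [h0', map_zero, map_zero, norm_zero] at h1
    have h2 := norm_le_partialNorm h0 a hk
    have h3 : partialNorm (p j).toReal a n ≤ 0 := nonpos_of_mul_nonpos_right h1 hc
    exact norm_eq_zero.1 (le_antisymm (h2.trans h3) (norm_nonneg _))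
  · obtain ⟨n, a, rfl⟩ := exists_eq_sum_range_of_mem_span hx
    obtain ⟨h1, h2⟩ := hest n a
    set v := ∑ k ∈ Finset.range n, a k • z (ψ (φ k))
    have h3 := (π j).le_opNorm (S v)
    rw [div_mul_eq_mul_div, div_le_iff₀ (by positivity)]
    calc c * ‖v‖ ≤ c * (C' * partialNorm (p j).toReal a n) := by gcongr
      _ = C' * (c * partialNorm (p j).toReal a n) := by ring
      _ ≤ C' * (‖π j‖ * ‖S v‖) := mul_le_mul_of_nonneg_left (h2.trans h3) hC'.le
      _ ≤ ‖S v‖ * (C' * (‖π j‖ + 1)) := by nlinarith [norm_nonneg (S v)]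

theorem tendsto_proj (h : IsLpSum p π ι) (hp : ∀ j, p j ≠ ∞) (hmono : StrictMono p)
    {S : X →L[𝕜] X} (hS : IsStrictlySingular S) {j : ℕ} {z : ℕ → X}
    (hz : ∀ f : X →L[𝕜] 𝕜, Tendsto (fun m => f (z m)) atTop (𝓝 0)) {C : ℝ} (hC : ∀ m, ‖z m‖ ≤ C)
    (hzj : ∀ i < j, Tendsto (fun m => π i (z m)) atTop (𝓝 0)) :
    Tendsto (fun m => π j (S (z m))) atTop (𝓝 0) := by
  set P : X →L[𝕜] X := ∑ i ∈ Finset.range j, ι i ∘L π i with hP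
  have hPx : ∀ x, P x = ∑ i ∈ Finset.range j, ι i (π i x) := fun x => by simp [hP, sum_apply]
  have hPz : Tendsto (fun m => P (z m)) atTop (𝓝 0) := by
    simp only [hPx]
    rw [← Finset.sum_const_zero (s := Finset.range j)]
    refine tendsto_finsetSum _ fun i hi => ?_
    have := ((ι i).continuous.tendsto 0).comp (hzj i (Finset.mem_range.1 hi))
    rwa [map_zero] at this
  have h1 : Tendsto (fun m => π j (S (P (z m)))) atTop (𝓝 0) := by
    have := ((π j ∘L S).continuous.tendsto 0).comp hPz
    rwa [map_zero] at this
  have h2 : Tendsto (fun m => π j (S (z m - P (z m)))) atTop (𝓝 0) := by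
    refine h.tendsto_proj_of_mem_tail hp hmono hS (z := fun m => z m - P (z m))
      (fun f => ?_) (C := C + ‖P‖ * C) (fun m => ?_) (fun m => ?_)
    · simpa using (hz f).sub (hz (f ∘L P))
    · refine (norm_sub_le _ _).trans (add_le_add (hC m) ((P.le_opNorm _).trans ?_))
      have := hC m
      gcongr
    · rw [mem_tail]
      intro i hi
      rw [map_sub, hPx, h.proj_sum_incl (fun i => π i (z m)), if_pos hi, sub_self]
  simpa using h2.add h1

end IsLpSum

end Sums

section Chain

variable {𝕜 : Type*} [RCLike 𝕜] {X : Type*} [NormedAddCommGroup X] [NormedSpace 𝕜 X]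
  {p : ℕ → ℝ≥0∞} [∀ j, Fact (1 ≤ p j)] {π : ∀ j, X →L[𝕜] lp (fun _ : ℕ => 𝕜) (p j)}
  {ι : ∀ j, lp (fun _ : ℕ => 𝕜) (p j) →L[𝕜] X}

/-- The strictly singular operators on a Banach space over `𝕜` start a strictly decreasing chain of
closed subideals of increasing depth. -/
def HasSubidealChain (𝕜 : Type*) [RCLike 𝕜] (X : Type*) [NormedAddCommGroup X]
    [NormedSpace 𝕜 X] : Prop :=
  ∃ M : ℕ → NonUnitalSubalgebra 𝕜 (X →L[𝕜] X),
    (M 0 : Set (X →L[𝕜] X)) = {T : X →L[𝕜] X | IsStrictlySingular T} ∧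
    (∀ n : ℕ, IsClosed (M n : Set (X →L[𝕜] X))) ∧
    (∀ n : ℕ, (M (n + 1) : Set (X →L[𝕜] X)) ⊂ (M n : Set (X →L[𝕜] X))) ∧
    (∀ n : ℕ, IsIdealOf (M (n + 1)) (M n)) ∧
    ∀ n : ℕ, 1 ≤ n →
      IsClosedNSubideal 𝕜 (n + 1) (M n : Set (X →L[𝕜] X)) ∧
      ¬IsClosedNSubideal 𝕜 n (M n : Set (X →L[𝕜] X))

/-- The even-numbered unit vectors of the summand with index `1`. -/
def evenUnit (ι : ∀ j, lp (fun _ : ℕ => 𝕜) (p j) →L[𝕜] X) (m : ℕ) : X :=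
  ι 1 (lp.single (p 1) (2 * m) 1)

theorem norm_evenUnit_le (m : ℕ) : ‖evenUnit ι m‖ ≤ ‖ι 1‖ := by
  have h := (ι 1).le_opNorm (lp.single (p 1) (2 * m) (1 : 𝕜))
  rwa [lp.norm_single (zero_lt_one.trans_le Fact.out), norm_one, mul_one] at h

theorem tendsto_apply_evenUnit (hp : ∀ j, p j ≠ ∞) (hmono : StrictMono p) (f : X →L[𝕜] 𝕜) :
    Tendsto (fun m => f (evenUnit ι m)) atTop (𝓝 0) := by
  have h1 : 1 < p 1 := (Fact.out : 1 ≤ p 0).trans_lt (hmono zero_lt_one)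
  exact (tendsto_apply_single h1 (hp 1) (f ∘L ι 1)).comp
    (tendsto_id.const_mul_atTop' (by norm_num))

/-- The set of the strictly singular operators on `X` whose components with index at most `n + 1`
send the even-numbered unit vectors of `ℓ^{p_1}` to a null sequence. -/
def chainSet (π : ∀ j, X →L[𝕜] lp (fun _ : ℕ => 𝕜) (p j))
    (ι : ∀ j, lp (fun _ : ℕ => 𝕜) (p j) →L[𝕜] X) (n : ℕ) : Set (X →L[𝕜] X) :=
  {T | IsStrictlySingular T ∧
    ∀ j < n + 2, Tendsto (fun m => π j (T (evenUnit ι m))) atTop (𝓝 0)}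

theorem chainSet_succ_subset (n : ℕ) : chainSet π ι (n + 1) ⊆ chainSet π ι n :=
  fun _ hT => ⟨hT.1, fun j hj => hT.2 j (by omega)⟩

theorem isClosed_chainSet (n : ℕ) : IsClosed (chainSet π ι n) := by
  have hset : chainSet π ι n = {T : X →L[𝕜] X | IsStrictlySingular T} ∩ ⋂ j < n + 2,
      {T : X →L[𝕜] X | Tendsto (fun m => π j (T (evenUnit ι m))) atTop (𝓝 0)} := by
    ext T
    simp [chainSet]
  rw [hset]
  refine isClosed_setOf_isStrictlySingular.inter
    (isClosed_biInter fun j _ => isClosed_of_closure_subset fun T hT => ?_)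
  rw [Set.mem_setOf_eq, Metric.tendsto_nhds]
  intro ε hε
  obtain ⟨T', hT', hdist⟩ := Metric.mem_closure_iff.1 hT
    (ε / 2 / (‖π j‖ * ‖ι 1‖ + 1)) (by positivity)
  filter_upwards [Metric.tendsto_nhds.1 hT' (ε / 2) (by positivity)] with m hm
  rw [dist_zero_right] at hm ⊢
  rw [dist_eq_norm, lt_div_iff₀ (by positivity)] at hdist
  have h1 : ‖π j ((T - T') (evenUnit ι m))‖ ≤ ‖π j‖ * (‖T - T'‖ * ‖ι 1‖) :=
    ((π j).le_opNorm _).trans <| mul_le_mul_of_nonneg_left (((T - T').le_opNorm _).trans <|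
      mul_le_mul_of_nonneg_left (norm_evenUnit_le m) (norm_nonneg _)) (norm_nonneg _)
  have h2 : π j (T (evenUnit ι m)) =
      π j ((T - T') (evenUnit ι m)) + π j (T' (evenUnit ι m)) := by simp
  rw [h2]
  have h3 := norm_add_le (π j ((T - T') (evenUnit ι m))) (π j (T' (evenUnit ι m)))
  nlinarith [norm_nonneg (T - T')]

theorem exists_injective_odd_eq_even :
    ∃ s : ℕ → ℕ, Function.Injective s ∧ ∀ m, s (2 * m + 1) = 2 * m :=
  ⟨fun i => if i % 2 = 0 then i + 1 else i - 1, fun i j hij => by grind, fun m => by grind⟩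

namespace IsLpSum

theorem mul_mem_chainSet_succ (h : IsLpSum p π ι) (hp : ∀ j, p j ≠ ∞) (hmono : StrictMono p)
    {n : ℕ} {S T : X →L[𝕜] X} (hS : IsStrictlySingular S) (hT : T ∈ chainSet π ι n) :
    S * T ∈ chainSet π ι (n + 1) := by
  refine ⟨hT.1.comp_left S, fun j hj => ?_⟩
  refine h.tendsto_proj hp hmono hS (z := fun m => T (evenUnit ι m))
    (fun f => tendsto_apply_evenUnit hp hmono (f ∘L T)) (C := ‖T‖ * ‖ι 1‖) (fun m => ?_)
    fun i hi => hT.2 i (by omega)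
  exact (T.le_opNorm _).trans (mul_le_mul_of_nonneg_left (norm_evenUnit_le m) (norm_nonneg _))

theorem mul_mem_chainSet (h : IsLpSum p π ι) (hp : ∀ j, p j ≠ ∞) (hmono : StrictMono p) {n : ℕ}
    {S T : X →L[𝕜] X} (hS : IsStrictlySingular S) (hT : T ∈ chainSet π ι n) :
    S * T ∈ chainSet π ι n :=
  chainSet_succ_subset n (h.mul_mem_chainSet_succ hp hmono hS hT)

theorem chainSet_zero (h : IsLpSum p π ι) (hp : ∀ j, p j ≠ ∞) (hmono : StrictMono p) :
    chainSet π ι 0 = {T : X →L[𝕜] X | IsStrictlySingular T} := by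
  refine Set.Subset.antisymm (fun T hT => hT.1) fun T hT => ⟨hT, fun j hj => ?_⟩
  refine h.tendsto_proj hp hmono hT (tendsto_apply_evenUnit hp hmono) norm_evenUnit_le
    fun i hi => ?_
  have : ∀ m, π i (evenUnit ι m) = 0 := fun m => h.proj_incl_ne (by omega) _
  simp [this]

/-- The set `chainSet π ι n` as a subalgebra. -/
def chain (h : IsLpSum p π ι) (hp : ∀ j, p j ≠ ∞) (hmono : StrictMono p) (n : ℕ) :
    NonUnitalSubalgebra 𝕜 (X →L[𝕜] X) where
  carrier := chainSet π ι n
  zero_mem' := ⟨isStrictlySingular_zero, fun j _ => by simp⟩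
  add_mem' hS hT := ⟨hS.1.add hT.1, fun j hj => by simpa using (hS.2 j hj).add (hT.2 j hj)⟩
  mul_mem' hS hT := h.mul_mem_chainSet hp hmono hS.1 hT
  smul_mem' c _ hT := ⟨hT.1.smul c, fun j hj => by simpa using (hT.2 j hj).const_smul c⟩

theorem isIdealOf_chain (h : IsLpSum p π ι) (hp : ∀ j, p j ≠ ∞) (hmono : StrictMono p) (n : ℕ) :
    IsIdealOf (h.chain hp hmono (n + 1)) (h.chain hp hmono n) :=
  ⟨chainSet_succ_subset n, fun _ hS _ hT =>
    ⟨h.mul_mem_chainSet hp hmono hS.1 hT, h.mul_mem_chainSet_succ hp hmono hT.1 hS⟩⟩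

theorem isClosedNSubideal_chain (h : IsLpSum p π ι) (hp : ∀ j, p j ≠ ∞) (hmono : StrictMono p)
    (n : ℕ) : IsClosedNSubideal 𝕜 (n + 1) (h.chain hp hmono n : Set (X →L[𝕜] X)) := by
  refine ⟨fun k => Nat.casesOn k ⊤ (h.chain hp hmono), rfl, rfl, fun k _ => ?_, fun k _ => ?_⟩
  · cases k with
    | zero => exact isClosed_univ
    | succ k => exact isClosed_chainSet k
  · cases k with
    | zero =>
      refine ⟨Set.subset_univ _, fun S _ T hT => ?_⟩
      change S * T ∈ chainSet π ι 0 ∧ T * S ∈ chainSet π ι 0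
      have hT' : IsStrictlySingular T := hT.1
      rw [h.chainSet_zero hp hmono]
      exact ⟨hT'.comp_left S, hT'.comp_right S⟩
    | succ k => exact h.isIdealOf_chain hp hmono k

/-- An operator mapping the `i`-th summand to the `k`-th one which permutes the unit vectors and
kills the sequence `evenUnit` belongs to all subalgebras of the chain. -/
theorem incl_lpComp_proj_mem_chainSet (hp : ∀ j, p j ≠ ∞) {i k : ℕ} (hik : p i < p k) (g : ℕ → ℕ)
    (hg : Function.Injective g)
    (h0 : ∀ m, lpComp 𝕜 (hp i) hik.le g hg (π i (evenUnit ι m)) = 0) (n : ℕ) :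
    ι k ∘L lpComp 𝕜 (hp i) hik.le g hg ∘L π i ∈ chainSet π ι n :=
  ⟨((isStrictlySingular_lpComp (hp i) (hp k) hik g hg).comp_right (π i)).comp_left (ι k),
    fun j _ => by simp [h0]⟩

theorem not_isClosedNSubideal_chain (h : IsLpSum p π ι) (hp : ∀ j, p j ≠ ∞)
    (hmono : StrictMono p) {n : ℕ} (hn : 1 ≤ n) :
    ¬IsClosedNSubideal 𝕜 n (h.chain hp hmono n : Set (X →L[𝕜] X)) := by
  rintro ⟨C, hC0, hCn, -, hC⟩
  have hsub : ∀ k ≤ n, chainSet π ι n ⊆ C k := by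
    intro k hk
    induction hk using Nat.decreasingInduction with
    | self => exact hCn.symm.subset
    | of_succ k hk ih => exact ih.trans (hC k hk).1
  have hlt : ∀ k, p k < p (k + 1) := fun k => hmono k.lt_succ_self
  have hg : Function.Injective fun i : ℕ => 2 * i + 1 := fun i j hij => by simpa using hij
  have hy := incl_lpComp_proj_mem_chainSet (π := π) (ι := ι) hp (hlt 1) _ hg (fun m => by
    rw [evenUnit, h.proj_incl, lpComp_single_of_notMem]
    omega) n
  set y := ι 2 ∘L lpComp 𝕜 (hp 1) (hlt 1).le _ hg ∘L π 1 with hy_def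
  obtain ⟨s, hs, hs2⟩ := exists_injective_odd_eq_even
  set b : X →L[𝕜] X := ι 1 ∘L lpComp 𝕜 (hp 1) le_rfl s hs ∘L π 1 with hb_def
  have hyb : ∀ m, (y * b) (evenUnit ι m) = ι 2 (lp.single (p 2) m 1) := by
    intro m
    have h1 := lpComp_single (𝕜 := 𝕜) (hp 1) (le_refl (p 1)) s hs (2 * m + 1) 1
    have h2 := lpComp_single (𝕜 := 𝕜) (hp 1) (hlt 1).le _ hg m 1
    rw [hs2] at h1
    simp [hy_def, hb_def, evenUnit, h.proj_incl, h1, h2]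
  have key : ∀ k < n, ∃ w ∈ C (k + 1), ∀ m,
      w (evenUnit ι m) = ι (k + 2) (lp.single (p (k + 2)) m 1) := by
    intro k
    induction k with
    | zero =>
      intro hk
      have hb : b ∈ (C 0 : Set (X →L[𝕜] X)) := hC0 ▸ Set.mem_univ b
      exact ⟨y * b, ((hC 0 hk).2 b hb y (hsub 1 hk hy)).2, hyb⟩
    | succ k ih =>
      intro hk
      obtain ⟨w, hw, hwe⟩ := ih (by omega)
      have hx := incl_lpComp_proj_mem_chainSet (π := π) (ι := ι) hp (hlt (k + 2)) id
        Function.injective_id (fun m => by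
          rw [evenUnit, h.proj_incl_ne (by omega), map_zero]) n
      refine ⟨_, ((hC (k + 1) hk).2 w hw _ (hsub (k + 1 + 1) hk hx)).2, fun m => ?_⟩
      have h1 := lpComp_single (𝕜 := 𝕜) (hp (k + 2)) (hlt (k + 2)).le id
        Function.injective_id m 1
      rw [id] at h1
      simp [hwe, h.proj_incl, h1]
  obtain ⟨k, rfl⟩ := Nat.exists_eq_add_of_le' hn
  obtain ⟨w, hw, hwe⟩ := key k k.lt_succ_self
  have hw' : w ∈ chainSet π ι (k + 1) := hCn.subset hw
  have hlim := (hw'.2 (k + 2) (by omega)).norm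
  have hone : ∀ m, ‖π (k + 2) (w (evenUnit ι m))‖ = 1 := fun m => by
    rw [hwe, h.proj_incl, lp.norm_single (zero_lt_one.trans_le Fact.out), norm_one]
  simp only [hone, norm_zero] at hlim
  exact one_ne_zero (tendsto_nhds_unique tendsto_const_nhds hlim)

theorem hasSubidealChain (h : IsLpSum p π ι) (hp : ∀ j, p j ≠ ∞) (hmono : StrictMono p) :
    HasSubidealChain 𝕜 X := by
  refine ⟨h.chain hp hmono, h.chainSet_zero hp hmono, isClosed_chainSet, fun n => ?_,
    h.isIdealOf_chain hp hmono, fun n hn =>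
      ⟨h.isClosedNSubideal_chain hp hmono n, h.not_isClosedNSubideal_chain hp hmono hn⟩⟩
  refine (chainSet_succ_subset n).ssubset_of_ne fun heq => ?_
  refine h.not_isClosedNSubideal_chain hp hmono n.succ_pos ?_
  change IsClosedNSubideal 𝕜 (n + 1) (chainSet π ι (n + 1))
  rw [heq]
  exact h.isClosedNSubideal_chain hp hmono n

end IsLpSum

end Chain

section DirectSums

variable {𝕜 : Type*} [RCLike 𝕜] {V : ℕ → Type*} [∀ j, NormedAddCommGroup (V j)]
  [∀ j, NormedSpace 𝕜 (V j)] {r : ℝ≥0∞} [Fact (1 ≤ r)]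

theorem lp_norm_rpow_le_add (hr : r ≠ ∞) {s : ℝ} (hs : 0 < s) (hsr : s ≤ r.toReal) {x u v : lp V r}
    (h : ∀ k, ‖x k‖ ^ s ≤ ‖u k‖ ^ s + ‖v k‖ ^ s) : ‖x‖ ^ s ≤ ‖u‖ ^ s + ‖v‖ ^ s := by
  have h0 := toReal_pos_of_one_le hr
  have hpow : ∀ a : ℝ, 0 ≤ a → (a ^ s) ^ (r.toReal / s) = a ^ r.toReal := fun a ha => by
    rw [← Real.rpow_mul ha, mul_div_cancel₀ _ hs.ne']
  have hnorm : ∀ w : lp V r,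
      (∑' k, (‖w k‖ ^ s) ^ (r.toReal / s)) ^ (1 / (r.toReal / s)) = ‖w‖ ^ s := fun w => by
    simp only [hpow _ (norm_nonneg _)]
    rw [← lp.norm_rpow_eq_tsum h0, ← Real.rpow_mul (norm_nonneg _), one_div_div,
      mul_div_cancel₀ _ h0.ne']
  have hsum : ∀ w : lp V r, Summable fun k => (‖w k‖ ^ s) ^ (r.toReal / s) := fun w => by
    simpa only [hpow _ (norm_nonneg _)] using (lp.memℓp w).summable h0
  obtain ⟨h1, h2⟩ := Real.Lp_add_le_tsum_of_nonneg (p := r.toReal / s) ((one_le_div hs).2 hsr)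
    (f := fun k => ‖u k‖ ^ s) (g := fun k => ‖v k‖ ^ s) (fun _ => by positivity)
    (fun _ => by positivity) (hsum u) (hsum v)
  rw [hnorm, hnorm] at h2
  refine le_trans ?_ h2
  rw [← hnorm]
  refine Real.rpow_le_rpow (tsum_nonneg fun _ => by positivity)
    ((hsum x).tsum_le_tsum (fun k => ?_) h1) (by positivity)
  exact Real.rpow_le_rpow (by positivity) (h k) (by positivity)

theorem lp_norm_rpow_le_add_of_top {s : ℝ} (hs : 0 < s) {x u v : lp V ∞}
    (h : ∀ k, ‖x k‖ ^ s ≤ ‖u k‖ ^ s + ‖v k‖ ^ s) : ‖x‖ ^ s ≤ ‖u‖ ^ s + ‖v‖ ^ s := by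
  rw [← Real.le_rpow_inv_iff_of_pos (norm_nonneg _) (by positivity) hs]
  refine lp.norm_le_of_forall_le (by positivity) fun k => ?_
  rw [Real.le_rpow_inv_iff_of_pos (norm_nonneg _) (by positivity) hs]
  refine (h k).trans ?_
  have hu := lp.norm_apply_le_norm ENNReal.top_ne_zero u k
  have hv := lp.norm_apply_le_norm ENNReal.top_ne_zero v k
  gcongr

theorem single_mem_c0SumSubmodule (j : ℕ) (y : V j) :
    lp.single ∞ j y ∈ c0SumSubmodule 𝕜 V := by
  refine tendsto_const_nhds.congr' ?_
  filter_upwards [eventually_gt_atTop j] with k hk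
  rw [lp.single_apply_ne _ _ _ hk.ne', norm_zero]

variable (𝕜 V) in
/-- The inclusion of the `j`-th summand into the `c_0`-direct sum. -/
def c0SumIncl (j : ℕ) : V j →L[𝕜] c0SumSubmodule 𝕜 V :=
  (lp.singleContinuousLinearMap 𝕜 V ∞ j).codRestrict _ (single_mem_c0SumSubmodule j)

variable (𝕜 V) in
/-- The projection of the `c_0`-direct sum onto the `j`-th summand. -/
def c0SumProj (j : ℕ) : c0SumSubmodule 𝕜 V →L[𝕜] V j :=
  lp.evalCLM 𝕜 V ∞ j ∘L (c0SumSubmodule 𝕜 V).subtypeL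

theorem tendsto_sum_c0SumIncl (x : c0SumSubmodule 𝕜 V) :
    Tendsto (fun K => ∑ j ∈ Finset.range K, c0SumIncl 𝕜 V j (c0SumProj 𝕜 V j x)) atTop (𝓝 x) := by
  have hx : Tendsto (fun j => ‖(x : lp V ∞) j‖) atTop (𝓝 0) := x.2
  rw [Metric.tendsto_atTop]
  intro ε hε
  obtain ⟨N, hN⟩ := Metric.tendsto_atTop.1 hx (ε / 2) (by positivity)
  refine ⟨N, fun K hK => ?_⟩
  have hcoord : ∀ k, ((∑ j ∈ Finset.range K, c0SumIncl 𝕜 V j (c0SumProj 𝕜 V j x) :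
      c0SumSubmodule 𝕜 V) : lp V ∞) k = if k < K then (x : lp V ∞) k else 0 := by
    intro k
    rw [Submodule.coe_sum, lp.coeFn_sum, Finset.sum_apply]
    change ∑ j ∈ Finset.range K, lp.single ∞ j ((x : lp V ∞) j) k = _
    split_ifs with hk
    · rw [Finset.sum_eq_single_of_mem k (Finset.mem_range.2 hk) fun j _ hj =>
        lp.single_apply_ne _ _ _ hj.symm, lp.single_apply_self]
    · exact Finset.sum_eq_zero fun j hj =>
        lp.single_apply_ne _ _ _ (by rintro rfl; exact hk (Finset.mem_range.1 hj))
  rw [dist_eq_norm]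
  refine (lp.norm_le_of_forall_le (f := ((∑ j ∈ Finset.range K,
    c0SumIncl 𝕜 V j (c0SumProj 𝕜 V j x) - x : c0SumSubmodule 𝕜 V) : lp V ∞))
    (C := ε / 2) (by positivity) fun k => ?_).trans_lt (half_lt_self hε)
  rw [Submodule.coe_sub, lp.coeFn_sub, Pi.sub_apply, hcoord]
  split_ifs with hk
  · rw [sub_self, norm_zero]
    positivity
  · have := hN k (hK.trans (not_lt.1 hk))
    rw [dist_zero_right, norm_norm] at this
    rw [zero_sub, norm_neg]
    exact this.le

variable {p : ℕ → ℝ≥0∞} [∀ j, Fact (1 ≤ p j)]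

theorem isLpSum_lp (hp : ∀ j, p j ≠ ∞) (hr : ∀ j, p j ≤ r) (hr' : r ≠ ∞) :
    IsLpSum p (lp.evalCLM 𝕜 (fun j => lp (fun _ : ℕ => 𝕜) (p j)) r)
      (lp.singleContinuousLinearMap 𝕜 (fun j => lp (fun _ : ℕ => 𝕜) (p j)) r) where
  proj_incl _ _ := lp.single_apply_self r _ _
  proj_incl_ne h _ := lp.single_apply_ne r _ _ h
  tendsto x := (lp.hasSum_single hr' x).tendsto_sum_nat
  upper j _ _ _ h := lp_norm_rpow_le_add hr' (toReal_pos_of_one_le (hp j))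
    ((ENNReal.toReal_le_toReal (hp j) hr').2 (hr j)) h

theorem isLpSum_c0Sum (hp : ∀ j, p j ≠ ∞) :
    IsLpSum p (c0SumProj 𝕜 fun j => lp (fun _ : ℕ => 𝕜) (p j))
      (c0SumIncl 𝕜 fun j => lp (fun _ : ℕ => 𝕜) (p j)) where
  proj_incl _ _ := lp.single_apply_self ∞ _ _
  proj_incl_ne h _ := lp.single_apply_ne ∞ _ _ h
  tendsto := tendsto_sum_c0SumIncl
  upper j _ _ _ h := lp_norm_rpow_le_add_of_top (toReal_pos_of_one_le (hp j)) h

end DirectSums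

theorem hasSubidealChain_sumOfLp (𝕜 : Type) [RCLike 𝕜] (p : ℕ → ℝ≥0∞) [∀ j, Fact (1 ≤ p j)]
    (hp : ∀ j, p j ≠ ∞) (hmono : StrictMono p) (r : ℝ≥0∞) [Fact (1 ≤ r)] (hr : ∀ j, p j ≤ r) :
    HasSubidealChain 𝕜 (sumOfLp 𝕜 p r) := by
  change HasSubidealChain 𝕜 (sumSpB 𝕜 (fun j => lp (fun _ : ℕ => 𝕜) (p j)) r).carrier
  by_cases h : r = ∞
  · rw [show sumSpB 𝕜 (fun j => lp (fun _ : ℕ => 𝕜) (p j)) r = _ from if_pos h]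
    exact (isLpSum_c0Sum (𝕜 := 𝕜) hp).hasSubidealChain hp hmono
  · rw [show sumSpB 𝕜 (fun j => lp (fun _ : ℕ => 𝕜) (p j)) r = _ from if_neg h]
    exact (isLpSum_lp (𝕜 := 𝕜) hp hr h).hasSubidealChain hp hmono

/-- Let `(p_j)` be a strictly increasing sequence in `[1, ∞)`,
`E = ℓ^r` with `sup_j p_j ≤ r ≤ ∞` (convention `ℓ^∞ = c_0`), and
`X = (⊕_{j} ℓ^{p_j})_E`.  Then there is a strictly decreasing sequence `(M_n)_{n∈ℕ₀}` of
closed subalgebras of `L(X)` with `M_0 = S(X)` such that `M_n` is a closed two-sided ideal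
of `M_{n-1}` for every `n ∈ ℕ`, and for every `n ∈ ℕ` the subalgebra `M_n` is a closed
`(n+1)`-subideal of `L(X)` but not a closed `n`-subideal of `L(X)`. -/
theorem infinite_decreasing_chain_of_closed_subideals
    (𝕜 : Type) [RCLike 𝕜] (p : ℕ → ℝ≥0∞) [∀ j, Fact (1 ≤ p j)] (hpfin : ∀ j, p j ≠ ∞)
    (hpmono : StrictMono p) (r : ℝ≥0∞) [Fact (1 ≤ r)] (hr : ∀ j, p j ≤ r) :
    ∃ M : ℕ → NonUnitalSubalgebra 𝕜 (sumOfLp 𝕜 p r →L[𝕜] sumOfLp 𝕜 p r),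
      (M 0 : Set (sumOfLp 𝕜 p r →L[𝕜] sumOfLp 𝕜 p r)) =
        {T : sumOfLp 𝕜 p r →L[𝕜] sumOfLp 𝕜 p r | IsStrictlySingular T} ∧
      (∀ n : ℕ, IsClosed (M n : Set (sumOfLp 𝕜 p r →L[𝕜] sumOfLp 𝕜 p r))) ∧
      (∀ n : ℕ, (M (n + 1) : Set (sumOfLp 𝕜 p r →L[𝕜] sumOfLp 𝕜 p r)) ⊂
        (M n : Set (sumOfLp 𝕜 p r →L[𝕜] sumOfLp 𝕜 p r))) ∧
      (∀ n : ℕ, IsIdealOf (M (n + 1)) (M n)) ∧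
      ∀ n : ℕ, 1 ≤ n →
        IsClosedNSubideal 𝕜 (n + 1) (M n : Set (sumOfLp 𝕜 p r →L[𝕜] sumOfLp 𝕜 p r)) ∧
        ¬IsClosedNSubideal 𝕜 n (M n : Set (sumOfLp 𝕜 p r →L[𝕜] sumOfLp 𝕜 p r)) := by
  exact hasSubidealChain_sumOfLp 𝕜 p hpfin hpmono r hr

end
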